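/- Let ρ and ψ_c be scale functions and assume there is a constant C₅ > 0 such that ρ(r₂)/ρ(r₁) ≤ C₅ √(ψ_c(r₂)/ψ_c(r₁)) for all 0 < r₁ ≤ r₂. Then for every D > 0 and every s > 0: sup_{r>0} ( ρ(D)/ρ(r) − s/ψ_c(r) ) ≤ max( C₅² ψ_c(D)/(4s), 1 ). -/

import Mathlib

open scoped ENNReal

/-- A scale function with constant `C` and exponents `β₁ ≤ β₂`:
a positive, continuous, strictly increasing function on `(0,∞)` tending to `0`
at `0⁺` and to `∞` at `∞`, with two-sided power-type comparison. -/
structure IsScale (φ : ℝ → ℝ) (C β₁ β₂ : ℝ) : Prop where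
  one_le_C : 1 ≤ C
  beta1_pos : 0 < β₁
  beta_le : β₁ ≤ β₂
  pos : ∀ r : ℝ, 0 < r → 0 < φ r
  cont : ContinuousOn φ (Set.Ioi 0)
  mono : StrictMonoOn φ (Set.Ioi 0)
  tendsto_zero : Filter.Tendsto φ (nhdsWithin 0 (Set.Ioi 0)) (nhds 0)
  tendsto_top : Filter.Tendsto φ Filter.atTop Filter.atTop
  lower : ∀ s t : ℝ, 0 < s → s ≤ t → C⁻¹ * (t / s) ^ β₁ ≤ φ t / φ s
  upper : ∀ s t : ℝ, 0 < s → s ≤ t → φ t / φ s ≤ C * (t / s) ^ β₂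

/-- The set of values `ρ(D)/ρ(r) − s/ψ_c(r)` over `r > 0`. -/
def supSet (ρ ψc : ℝ → ℝ) (D s : ℝ) : Set ℝ :=
  {v : ℝ | ∃ r : ℝ, 0 < r ∧ v = ρ D / ρ r - s / ψc r}

/-- If `ρ(r₂)/ρ(r₁) ≤ C₅ √(ψ_c(r₂)/ψ_c(r₁))` for all `0 < r₁ ≤ r₂`,
then for all `D, s > 0`:
`sup_{r>0}(ρ(D)/ρ(r) − s/ψ_c(r)) ≤ max(C₅² ψ_c(D)/(4s), 1)`. -/
theorem sup_bound_near_diagonal (ρ ψc : ℝ → ℝ) (Cρ γ₁ γ₂ Cc β₁ β₂ C₅ : ℝ)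
    (hρ : IsScale ρ Cρ γ₁ γ₂)
    (hψc : IsScale ψc Cc β₁ β₂)
    (hC₅ : 0 < C₅)
    (hcomp : ∀ r₁ r₂ : ℝ, 0 < r₁ → r₁ ≤ r₂ →
      ρ r₂ / ρ r₁ ≤ C₅ * Real.sqrt (ψc r₂ / ψc r₁)) :
    ∀ D s : ℝ, 0 < D → 0 < s →
      BddAbove (supSet ρ ψc D s) ∧
      sSup (supSet ρ ψc D s) ≤ max (C₅ ^ 2 * ψc D / (4 * s)) 1 := by
  intro D s hD hs
  have bound : ∀ v ∈ supSet ρ ψc D s, v ≤ max (C₅ ^ 2 * ψc D / (4 * s)) 1 := by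
    rintro v ⟨r, hr, rfl⟩
    have hψr := hψc.pos r hr
    have hψD := hψc.pos D hD
    rcases le_total r D with h | h
    · refine le_max_of_le_left ?_
      have hle := hcomp r D hr h
      set x := Real.sqrt (ψc D / ψc r) with hx
      have hx2 : x ^ 2 = ψc D / ψc r := Real.sq_sqrt (div_pos hψD hψr).le
      have hs_eq : s / ψc r = s * x ^ 2 / ψc D := by
        rw [hx2]
        field_simp
      have hsquare : C₅ ^ 2 * ψc D / (4 * s) - (C₅ * x - s * x ^ 2 / ψc D)
          = (C₅ * ψc D - 2 * s * x) ^ 2 / (4 * s * ψc D) := by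
        field_simp
        ring
      have hnonneg : 0 ≤ (C₅ * ψc D - 2 * s * x) ^ 2 / (4 * s * ψc D) := by positivity
      linarith
    · refine le_max_of_le_right ?_
      have hle : ρ D / ρ r ≤ 1 :=
        (div_le_one (hρ.pos r hr)).2 (hρ.mono.monotoneOn hD hr h)
      have hnonneg : 0 ≤ s / ψc r := by positivity
      linarith
  exact ⟨⟨_, bound⟩, csSup_le ⟨_, D, hD, rfl⟩ bound⟩
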